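/- Assume β > 157/17. For every T > 0, M ≥ 1 and ε ∈ (0,1] there exists a constant C > 0, depending only on M, ε and T, such that every smooth solution (v,u,θ,q) of the radiation hydrodynamics system on [0,T] with (M,ε)-bounded initial data satisfies θ(t,x) ≥ C for all (t,x) ∈ [0,T] × 𝕋. -/

import Mathlib

open MeasureTheory Real Set

noncomputable section

namespace RadHydro

/-- Integral over one period `[-1/2, 1/2]` of the torus `𝕋 ≅ ℝ/ℤ`. -/
def tInt (f : ℝ → ℝ) : ℝ := ∫ x in (-(1/2) : ℝ)..(1/2 : ℝ), f x

/-- Squared `L²` norm over the torus. -/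
def L2sq (f : ℝ → ℝ) : ℝ := tInt fun x => (f x) ^ 2

/-- `L^∞` norm over the torus. -/
def Linf (f : ℝ → ℝ) : ℝ := sSup ((fun x => |f x|) '' Icc (-(1/2) : ℝ) (1/2))

/-- Squared `H¹` norm over the torus. -/
def H1sq (f : ℝ → ℝ) : ℝ := L2sq f + L2sq (deriv f)

/-- Squared `H²` norm over the torus. -/
def H2sq (f : ℝ → ℝ) : ℝ := L2sq f + L2sq (deriv f) + L2sq (deriv (deriv f))

/-- Partial derivative in the time variable. -/
def pt (f : ℝ → ℝ → ℝ) (t x : ℝ) : ℝ := deriv (fun s => f s x) t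

/-- Partial derivative in the space variable. -/
def px (f : ℝ → ℝ → ℝ) (t x : ℝ) : ℝ := deriv (f t) x

/-- The heat conductivity `κ(v, θ) = κ₁ + κ₂ v θ^β`. -/
def kappa (κ₁ κ₂ β v θ : ℝ) : ℝ := κ₁ + κ₂ * v * θ ^ β

/-- A smooth solution of the radiation hydrodynamics system (in Lagrangian
coordinates) on `[0, T]`: four `C^∞` functions on `[0,T] × ℝ` (modelled as smooth
functions on all of `ℝ × ℝ`), `1`-periodic in the space variable, with `v > 0`,
`θ > 0`, satisfying the four equations pointwise for `t ∈ [0, T]`, and with the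
normalization `∫_𝕋 v(0, x) dx = 1`. -/
structure Sol (μ R a b κ₁ κ₂ β γ T : ℝ) where
  v : ℝ → ℝ → ℝ
  u : ℝ → ℝ → ℝ
  θ : ℝ → ℝ → ℝ
  q : ℝ → ℝ → ℝ
  smooth_v : ContDiff ℝ (⊤ : ℕ∞) fun p : ℝ × ℝ => v p.1 p.2
  smooth_u : ContDiff ℝ (⊤ : ℕ∞) fun p : ℝ × ℝ => u p.1 p.2
  smooth_θ : ContDiff ℝ (⊤ : ℕ∞) fun p : ℝ × ℝ => θ p.1 p.2
  smooth_q : ContDiff ℝ (⊤ : ℕ∞) fun p : ℝ × ℝ => q p.1 p.2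
  periodic_v : ∀ t, Function.Periodic (v t) 1
  periodic_u : ∀ t, Function.Periodic (u t) 1
  periodic_θ : ∀ t, Function.Periodic (θ t) 1
  periodic_q : ∀ t, Function.Periodic (q t) 1
  v_pos : ∀ t x, 0 < v t x
  θ_pos : ∀ t x, 0 < θ t x
  eq_mass : ∀ t ∈ Icc (0 : ℝ) T, ∀ x : ℝ, pt v t x - px u t x = 0
  eq_mom : ∀ t ∈ Icc (0 : ℝ) T, ∀ x : ℝ,
    pt u t x + px (fun s y => R * θ s y / v s y) t x
      = px (fun s y => μ * px u s y / v s y) t x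
  eq_energy : ∀ t ∈ Icc (0 : ℝ) T, ∀ x : ℝ,
    pt (fun s y => R / (γ - 1) * θ s y + (u s y) ^ 2 / 2) t x
      + px (fun s y => R * θ s y / v s y * u s y) t x + px q t x
      = px (fun s y => μ * u s y * px u s y / v s y) t x
        + px (fun s y => kappa κ₁ κ₂ β (v s y) (θ s y) * px θ s y / v s y) t x
  eq_rad : ∀ t ∈ Icc (0 : ℝ) T, ∀ x : ℝ,
    -px (fun s y => px q s y / v s y) t x + a * v t x * q t x
      + b * px (fun s y => (θ s y) ^ 4) t x = 0
  mean_v : tInt (v 0) = 1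

/-- `(M, ε)`-bounded initial data: `‖(v₀, u₀, θ₀)‖_{H²} ≤ M` and `v₀ ≥ ε`, `θ₀ ≥ ε`. -/
def DataBounded (M ε : ℝ) (v₀ u₀ θ₀ : ℝ → ℝ) : Prop :=
  Real.sqrt (H2sq v₀ + H2sq u₀ + H2sq θ₀) ≤ M ∧ (∀ x, ε ≤ v₀ x) ∧ ∀ x, ε ≤ θ₀ x

variable {μ R a b κ₁ κ₂ β γ T : ℝ}

/-- A solution has `(M, ε)`-bounded initial data. -/
def Sol.Bounded (S : Sol μ R a b κ₁ κ₂ β γ T) (M ε : ℝ) : Prop :=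
  DataBounded M ε (S.v 0) (S.u 0) (S.θ 0)

/-- The auxiliary function `𝔛(t) = ∫₀ᵗ ∫_𝕋 κ(v,θ) θ_t² / v dx ds`. -/
def Sol.X (S : Sol μ R a b κ₁ κ₂ β γ T) (t : ℝ) : ℝ :=
  ∫ s in (0 : ℝ)..t, tInt fun x =>
    kappa κ₁ κ₂ β (S.v s x) (S.θ s x) * (pt S.θ s x) ^ 2 / S.v s x

/-- The auxiliary function `𝔜(t) = max_{0 ≤ s ≤ t} ∫_𝕋 κ(v,θ)² θ_x² / v² dx`. -/
def Sol.Y (S : Sol μ R a b κ₁ κ₂ β γ T) (t : ℝ) : ℝ :=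
  sSup ((fun s => tInt fun x =>
    (kappa κ₁ κ₂ β (S.v s x) (S.θ s x)) ^ 2 * (px S.θ s x) ^ 2 / (S.v s x) ^ 2) ''
      Icc (0 : ℝ) t)

/-- The auxiliary function `ℨ(t) = max_{0 ≤ s ≤ t} ∫_𝕋 u_{xx}² / v² dx`. -/
def Sol.Z (S : Sol μ R a b κ₁ κ₂ β γ T) (t : ℝ) : ℝ :=
  sSup ((fun s => tInt fun x => (px (px S.u) s x) ^ 2 / (S.v s x) ^ 2) '' Icc (0 : ℝ) t)

/-- The exponent `𝔗₀(n, p, β)`. -/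
def T0 (n _p β : ℝ) : ℝ :=
  if n < (β + 3) / 2 then 4 / (n * (2 * β + 3)) else (n - β + 5) / (n * (2 * β + 3))

/-- The exponent `𝔗₁(n, β)`. -/
def T1 (n β : ℝ) : ℝ := max (T0 n 8 β) (1 / (2 * β + 3) + T0 n 1 β)

/-- The exponent `𝔘ʸ₁₁(n, β)`. -/
def Uy11 (n β : ℝ) : ℝ := 2 / (2 * β + 3) + T0 n 1 β

/-- The exponent `𝔘ᶻ₁₁(n, β)`. -/
def Uz11 (n β : ℝ) : ℝ := 3 / 4 * (1 / (1 - T0 n (5/2) β))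

/-- The exponent `𝔘ʸ₂(n, β)`. -/
def Uy2 (n β : ℝ) : ℝ := 2 / (2 * β + 3) + T1 n β

/-- The exponent `𝔘ᶻ₂(n, β)`. -/
def Uz2 (n β : ℝ) : ℝ := 3 / 4 * (1 / (1 - T0 n (3/2) β - T1 n β))

end RadHydro

open RadHydro

namespace RadHydro

/-- Joint `C^∞` regularity of a function of time and space. -/
abbrev JointlySmooth (f : ℝ → ℝ → ℝ) : Prop :=
  ContDiff ℝ (⊤ : ℕ∞) fun p : ℝ × ℝ => f p.1 p.2

section Calculus

theorem deriv_deriv_nonneg_of_isLocalMin {f : ℝ → ℝ} {x : ℝ} (h : IsLocalMin f x)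
    (hc : ContinuousAt f x) : 0 ≤ deriv (deriv f) x := by
  by_contra! hneg
  have hmax := isLocalMax_of_deriv_deriv_neg hneg h.deriv_eq_zero hc
  have heq : f =ᶠ[nhds x] fun _ => f x := by
    filter_upwards [h, hmax] with y hy hy'
    exact le_antisymm hy' hy
  have h2 := heq.deriv.deriv_eq
  simp at h2
  linarith

/-- At a maximum over `[0, T]` attained at a positive point the derivative is nonnegative. -/
theorem deriv_nonneg_of_le_left {f : ℝ → ℝ} {f' t : ℝ} (ht : 0 < t)
    (hf : HasDerivAt f f' t) (hle : ∀ s ∈ Icc 0 t, f s ≤ f t) : 0 ≤ f' := by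
  have h := (hasDerivAt_iff_tendsto_slope_left_right.1 hf).1
  refine ge_of_tendsto h ?_
  filter_upwards [Ioo_mem_nhdsLT ht] with s hs
  rw [slope_def_field]
  exact div_nonneg_of_nonpos (sub_nonpos.2 (hle s ⟨hs.1.le, hs.2.le⟩)) (sub_nonpos.2 hs.2.le)

theorem exists_global_min_of_periodic {f : ℝ → ℝ} (hf : Continuous f)
    (hp : Function.Periodic f 1) : ∃ x, ∀ y, f x ≤ f y := by
  obtain ⟨x, -, hx⟩ := isCompact_Icc.exists_isMinOn (s := Icc (0 : ℝ) 1)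
    (nonempty_Icc.2 zero_le_one) hf.continuousOn
  refine ⟨x, fun y => ?_⟩
  obtain ⟨z, hz, hyz⟩ := hp.exists_mem_Ico₀ one_pos y
  rw [hyz]
  exact hx (Ico_subset_Icc_self hz)

theorem tInt_deriv_of_periodic {f : ℝ → ℝ} (hf : ContDiff ℝ 1 f)
    (hp : Function.Periodic f 1) : tInt (deriv f) = 0 := by
  unfold tInt
  rw [intervalIntegral.integral_deriv_eq_sub
    (fun x _ => (hf.differentiable one_ne_zero).differentiableAt)
    ((hf.continuous_deriv le_rfl).intervalIntegrable _ _), sub_eq_zero]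
  have := hp (-(1/2))
  norm_num at this ⊢
  exact this

theorem hasDerivAt_intervalIntegral_param {F F' : ℝ → ℝ → ℝ}
    (hF : Continuous fun p : ℝ × ℝ => F p.1 p.2) (hF' : Continuous fun p : ℝ × ℝ => F' p.1 p.2)
    (h : ∀ t x, HasDerivAt (fun s => F s x) (F' t x) t) (a b t : ℝ) :
    HasDerivAt (fun s => ∫ x in a..b, F s x) (∫ x in a..b, F' t x) t := by
  obtain ⟨C, hC⟩ :=
    ((isCompact_closedBall t 1).prod (isCompact_uIcc (a := a) (b := b))).exists_bound_of_continuousOn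
      hF'.continuousOn
  have hs : ∀ s, Continuous (F s) := fun s => hF.comp (Continuous.prodMk_right s)
  have hs' : ∀ s, Continuous (F' s) := fun s => hF'.comp (Continuous.prodMk_right s)
  refine (intervalIntegral.hasDerivAt_integral_of_dominated_loc_of_deriv_le
    (bound := fun _ => C) (Metric.closedBall_mem_nhds t one_pos)
    (Filter.Eventually.of_forall fun s => (hs s).aestronglyMeasurable)
    ((hs t).intervalIntegrable _ _) (hs' t).aestronglyMeasurable
    (Filter.Eventually.of_forall fun x hx s hs => ?_) intervalIntegrable_const
    (Filter.Eventually.of_forall fun x _ s _ => h s x)).2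
  exact hC (s, x) ⟨hs, uIoc_subset_uIcc hx⟩

end Calculus

namespace JointlySmooth

variable {f : ℝ → ℝ → ℝ}

theorem slice (hf : JointlySmooth f) (t : ℝ) : ContDiff ℝ (⊤ : ℕ∞) (f t) :=
  hf.comp (contDiff_prodMk_right t)

theorem hasDerivAt_px (hf : JointlySmooth f) (t x : ℝ) : HasDerivAt (f t) (px f t x) x :=
  ((hf.slice t).differentiable (by simp)).differentiableAt.hasDerivAt

theorem hasDerivAt_pt (hf : JointlySmooth f) (t x : ℝ) :
    HasDerivAt (fun s => f s x) (pt f t x) t :=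
  (((hf.comp (contDiff_prodMk_left x) : ContDiff ℝ (⊤ : ℕ∞) fun s => f s x)).differentiable
    (by simp)).differentiableAt.hasDerivAt

theorem px_smooth (hf : JointlySmooth f) : JointlySmooth (px f) := by
  have h : (fun p : ℝ × ℝ => px f p.1 p.2)
      = fun p => fderiv ℝ (fun p : ℝ × ℝ => f p.1 p.2) p (0, 1) := by
    funext p
    have h1 := ((hf.differentiable (by simp)).differentiableAt (x := p)).hasFDerivAt
    exact (h1.comp_hasDerivAt p.2 ((hasDerivAt_const p.2 p.1).prodMk (hasDerivAt_id p.2))).deriv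
  unfold JointlySmooth
  rw [h]
  exact (hf.fderiv_right (m := (⊤ : ℕ∞)) (by simp)).clm_apply contDiff_const

theorem pt_smooth (hf : JointlySmooth f) : JointlySmooth (pt f) := by
  have h : (fun p : ℝ × ℝ => pt f p.1 p.2)
      = fun p => fderiv ℝ (fun p : ℝ × ℝ => f p.1 p.2) p (1, 0) := by
    funext p
    have h1 := ((hf.differentiable (by simp)).differentiableAt (x := p)).hasFDerivAt
    exact (h1.comp_hasDerivAt p.1 ((hasDerivAt_id p.1).prodMk (hasDerivAt_const p.1 p.2))).deriv
  unfold JointlySmooth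
  rw [h]
  exact (hf.fderiv_right (m := (⊤ : ℕ∞)) (by simp)).clm_apply contDiff_const

theorem hasDerivAt_tInt (hf : JointlySmooth f) (t : ℝ) :
    HasDerivAt (fun s => tInt (f s)) (tInt (pt f t)) t :=
  hasDerivAt_intervalIntegral_param hf.continuous hf.pt_smooth.continuous hf.hasDerivAt_pt _ _ t

end JointlySmooth

theorem px_periodic {f : ℝ → ℝ → ℝ} (hp : ∀ t, Function.Periodic (f t) 1) (t : ℝ) :
    Function.Periodic (px f t) 1 := by
  intro x
  have h : (fun y => f t (y + 1)) = f t := funext (hp t)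
  unfold px
  rw [← deriv_comp_add_const, h]

/-- Minimum principle for the elliptic radiation equation: the flux is not expanding at a point
of minimal temperature. -/
theorem deriv_flux_nonpos_of_min {a b : ℝ} (ha : 0 < a) (hb : 0 < b) {v θ q : ℝ → ℝ}
    (hv : ContDiff ℝ (⊤ : ℕ∞) v) (hθ : ContDiff ℝ (⊤ : ℕ∞) θ) (hq : ContDiff ℝ (⊤ : ℕ∞) q)
    (pv : Function.Periodic v 1) (pθ : Function.Periodic θ 1) (pq : Function.Periodic q 1)
    (vpos : ∀ x, 0 < v x) (θpos : ∀ x, 0 < θ x)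
    (heq : ∀ x, -deriv (fun y => deriv q y / v y) x + a * v x * q x
      + b * deriv (fun y => θ y ^ 4) x = 0)
    {x₀ : ℝ} (hx₀ : ∀ y, θ x₀ ≤ θ y) : deriv q x₀ ≤ 0 := by
  have hq' : ContDiff ℝ (⊤ : ℕ∞) (deriv q) := (contDiff_infty_iff_deriv.1 hq).2
  have pq' : Function.Periodic (deriv q) 1 := by
    intro x
    have h : (fun y => q (y + 1)) = q := funext pq
    rw [← deriv_comp_add_const, h]
  have hdw : Differentiable ℝ fun y => deriv q y / v y :=
    (hq'.differentiable (by simp)).div (hv.differentiable (by simp)) fun x => (vpos x).ne'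
  have hd4 : Differentiable ℝ fun y => θ y ^ 4 := (hθ.differentiable (by simp)).pow 4
  set E : ℝ → ℝ := fun y => b * θ y ^ 4 - deriv q y / v y with hE
  have hdE : Differentiable ℝ E := (hd4.const_mul b).sub hdw
  have hE' : deriv E = fun x => -(a * v x * q x) := by
    funext x
    have := (((hd4 x).hasDerivAt.const_mul b).sub (hdw x).hasDerivAt).deriv
    rw [show deriv E x = _ from this]
    linarith [heq x]
  have pE : Function.Periodic E 1 := fun x => by simp only [hE, pθ x, pq' x, pv x]
  obtain ⟨x₁, hx₁⟩ := exists_global_min_of_periodic hdE.continuous pE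
  have hmin : IsLocalMin E x₁ := Filter.Eventually.of_forall hx₁
  have hq0 : q x₁ = 0 := by
    have := hmin.deriv_eq_zero
    rw [hE'] at this
    have := vpos x₁
    simp_all [ha.ne', this.ne']
  have h2 := deriv_deriv_nonneg_of_isLocalMin hmin hdE.continuous.continuousAt
  have hv1 := (hv.differentiable (by simp) x₁).hasDerivAt
  have hq1 := (hq.differentiable (by simp) x₁).hasDerivAt
  rw [hE', show deriv (fun x => -(a * v x * q x)) x₁ = _ from
    ((hv1.const_mul a).mul hq1).neg.deriv, hq0] at h2
  have hqx : deriv q x₁ ≤ 0 := by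
    by_contra! hpos
    have := mul_pos (mul_pos ha (vpos x₁)) hpos
    linarith
  have h3 : deriv q x₁ / v x₁ ≤ 0 := div_nonpos_of_nonpos_of_nonneg hqx (vpos x₁).le
  have h4 : θ x₀ ^ 4 ≤ θ x₁ ^ 4 := pow_le_pow_left₀ (θpos x₀).le (hx₀ x₁) 4
  have h5 := hx₁ x₀
  have h6 := mul_le_mul_of_nonneg_left h4 hb.le
  simp only [hE] at h5
  have h7 : deriv q x₀ / v x₀ ≤ 0 := by linarith
  by_contra! hpos
  exact absurd (div_pos hpos (vpos x₀)) (not_lt.2 h7)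

end RadHydro

namespace RadHydro

theorem tInt_add {f g : ℝ → ℝ} (hf : Continuous f) (hg : Continuous g) :
    tInt (fun x => f x + g x) = tInt f + tInt g :=
  intervalIntegral.integral_add (hf.intervalIntegrable _ _) (hg.intervalIntegrable _ _)

theorem tInt_sub {f g : ℝ → ℝ} (hf : Continuous f) (hg : Continuous g) :
    tInt (fun x => f x - g x) = tInt f - tInt g :=
  intervalIntegral.integral_sub (hf.intervalIntegrable _ _) (hg.intervalIntegrable _ _)

theorem tInt_const_mul (c : ℝ) (f : ℝ → ℝ) : tInt (fun x => c * f x) = c * tInt f :=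
  intervalIntegral.integral_const_mul _ _

theorem tInt_const (c : ℝ) : tInt (fun _ => c) = c := by
  simp [tInt]; ring

theorem continuous_const_mul {f : ℝ → ℝ} (c : ℝ) (hf : Continuous f) :
    Continuous fun x => c * f x :=
  continuous_const.mul hf

theorem tInt_mono {f g : ℝ → ℝ} (hf : Continuous f) (hg : Continuous g)
    (h : ∀ x ∈ Icc (-(1/2) : ℝ) (1/2), f x ≤ g x) : tInt f ≤ tInt g :=
  intervalIntegral.integral_mono_on (by norm_num) (hf.intervalIntegrable _ _)
    (hg.intervalIntegrable _ _) h

theorem tInt_nonneg {f : ℝ → ℝ} (h : ∀ x, 0 ≤ f x) : 0 ≤ tInt f :=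
  intervalIntegral.integral_nonneg (by norm_num) fun x _ => h x

theorem tInt_const_in_time {f J : ℝ → ℝ → ℝ} {T : ℝ} (hf : JointlySmooth f)
    (hJ : JointlySmooth J) (pJ : ∀ t, Function.Periodic (J t) 1)
    (h : ∀ t ∈ Icc (0 : ℝ) T, ∀ x, pt f t x = px J t x) {t : ℝ} (ht : t ∈ Icc (0 : ℝ) T) :
    tInt (f t) = tInt (f 0) := by
  refine constant_of_has_deriv_right_zero (f := fun t => tInt (f t)) (a := 0) (b := T)
    (fun s _ => (hf.hasDerivAt_tInt s).continuousAt.continuousWithinAt) (fun s hs => ?_) t ht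
  have h1 := hf.hasDerivAt_tInt s
  rw [funext (h s ⟨hs.1, hs.2.le⟩)] at h1
  have h2 : tInt (px J s) = 0 :=
    tInt_deriv_of_periodic ((hJ.slice s).of_le (by exact_mod_cast le_top)) (pJ s)
  rw [h2] at h1
  exact h1.hasDerivWithinAt

theorem L2sq_le_of_dataBounded {M ε : ℝ} {v₀ u₀ θ₀ : ℝ → ℝ} (hM : 0 ≤ M)
    (h : DataBounded M ε v₀ u₀ θ₀) : L2sq u₀ ≤ M ^ 2 ∧ L2sq θ₀ ≤ M ^ 2 := by
  have hn : ∀ f, 0 ≤ L2sq f := fun f => tInt_nonneg fun x => sq_nonneg _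
  have h1 := (Real.sqrt_le_left hM).1 h.1
  unfold H2sq at h1
  constructor <;>
  linarith [hn v₀, hn (deriv v₀), hn (deriv (deriv v₀)), hn u₀, hn (deriv u₀),
    hn (deriv (deriv u₀)), hn θ₀, hn (deriv θ₀), hn (deriv (deriv θ₀))]

namespace Sol

variable {μ R a b κ₁ κ₂ β γ T : ℝ} (S : Sol μ R a b κ₁ κ₂ β γ T)

/-- The total energy density. -/
def energy (t x : ℝ) : ℝ := R / (γ - 1) * S.θ t x + (S.u t x) ^ 2 / 2

/-- The pressure `Rθ/v`. -/
def pressure (t x : ℝ) : ℝ := R * S.θ t x / S.v t x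

/-- The viscous stress `μ u_x / v`. -/
def visc (t x : ℝ) : ℝ := μ * px S.u t x / S.v t x

/-- The effective viscous flux `μ u_x / v - Rθ/v`. -/
def stress (t x : ℝ) : ℝ := S.visc t x - S.pressure t x

/-- The conductivity coefficient `κ/v`. -/
def conduct (t x : ℝ) : ℝ := kappa κ₁ κ₂ β (S.v t x) (S.θ t x) / S.v t x

theorem v_ne (t x : ℝ) : S.v t x ≠ 0 := (S.v_pos t x).ne'

theorem smooth_energy : JointlySmooth S.energy :=
  (contDiff_const.mul S.smooth_θ).add ((S.smooth_u.pow 2).div_const 2)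

theorem smooth_pressure : JointlySmooth S.pressure :=
  (contDiff_const.mul S.smooth_θ).div S.smooth_v fun p => S.v_ne p.1 p.2

theorem smooth_visc : JointlySmooth S.visc :=
  (contDiff_const.mul (JointlySmooth.px_smooth S.smooth_u)).div S.smooth_v
    fun p => S.v_ne p.1 p.2

theorem smooth_stress : JointlySmooth S.stress := S.smooth_visc.sub S.smooth_pressure

theorem smooth_conduct : JointlySmooth S.conduct :=
  (contDiff_const.add ((contDiff_const.mul S.smooth_v).mul
    (S.smooth_θ.rpow_const_of_ne fun p => (S.θ_pos p.1 p.2).ne'))).div S.smooth_v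
    fun p => S.v_ne p.1 p.2

/-- The energy flux. -/
def energyFlux (t x : ℝ) : ℝ :=
  S.u t x * S.visc t x + S.conduct t x * px S.θ t x - S.pressure t x * S.u t x - S.q t x

theorem smooth_energyFlux : JointlySmooth S.energyFlux :=
  (((S.smooth_u.mul S.smooth_visc).add (S.smooth_conduct.mul
    (JointlySmooth.px_smooth S.smooth_θ))).sub (S.smooth_pressure.mul S.smooth_u)).sub S.smooth_q

theorem periodic_stress (t : ℝ) : Function.Periodic (S.stress t) 1 := fun x => by
  simp only [stress, visc, pressure, px_periodic S.periodic_u t x, S.periodic_v t x,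
    S.periodic_θ t x]

theorem periodic_energyFlux (t : ℝ) : Function.Periodic (S.energyFlux t) 1 := fun x => by
  simp only [energyFlux, visc, pressure, conduct, px_periodic S.periodic_u t x, S.periodic_v t x,
    S.periodic_θ t x, px_periodic S.periodic_θ t x, S.periodic_u t x, S.periodic_q t x]

variable {S} {t : ℝ}

theorem pt_v (ht : t ∈ Icc (0 : ℝ) T) (x : ℝ) : pt S.v t x = px S.u t x :=
  sub_eq_zero.1 (S.eq_mass t ht x)

theorem pt_u (ht : t ∈ Icc (0 : ℝ) T) (x : ℝ) : pt S.u t x = px S.stress t x := by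
  have h := S.eq_mom t ht x
  have h1 : px S.stress t x = px S.visc t x - px S.pressure t x :=
    ((S.smooth_visc.hasDerivAt_px t x).sub (S.smooth_pressure.hasDerivAt_px t x)).deriv
  have h2 : pt S.u t x + px S.pressure t x = px S.visc t x := h
  linarith

/-- The energy equation with all fluxes in product form. -/
theorem energy_balance (ht : t ∈ Icc (0 : ℝ) T) (x : ℝ) :
    pt S.energy t x + (px S.pressure t x * S.u t x + S.pressure t x * px S.u t x) + px S.q t x
      = (px S.u t x * S.visc t x + S.u t x * px S.visc t x)
        + (px S.conduct t x * px S.θ t x + S.conduct t x * px (px S.θ) t x) := by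
  have h := S.eq_energy t ht x
  have h1 : px (fun s y => R * S.θ s y / S.v s y * S.u s y) t x
      = px S.pressure t x * S.u t x + S.pressure t x * px S.u t x :=
    ((S.smooth_pressure.hasDerivAt_px t x).mul
      (JointlySmooth.hasDerivAt_px S.smooth_u t x)).deriv
  have h2 : px (fun s y => μ * S.u s y * px S.u s y / S.v s y) t x
      = px S.u t x * S.visc t x + S.u t x * px S.visc t x := by
    have e : (fun s y => μ * S.u s y * px S.u s y / S.v s y)
        = fun s y => S.u s y * S.visc s y := by
      funext s y; unfold visc; ring
    rw [e]
    exact ((JointlySmooth.hasDerivAt_px S.smooth_u t x).mul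
      (S.smooth_visc.hasDerivAt_px t x)).deriv
  have h3 : px (fun s y => kappa κ₁ κ₂ β (S.v s y) (S.θ s y) * px S.θ s y / S.v s y) t x
      = px S.conduct t x * px S.θ t x + S.conduct t x * px (px S.θ) t x := by
    have e : (fun s y => kappa κ₁ κ₂ β (S.v s y) (S.θ s y) * px S.θ s y / S.v s y)
        = fun s y => S.conduct s y * px S.θ s y := by
      funext s y; unfold conduct; ring
    rw [e]
    exact ((S.smooth_conduct.hasDerivAt_px t x).mul
      ((JointlySmooth.px_smooth S.smooth_θ).hasDerivAt_px t x)).deriv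
  rw [h1, h2, h3] at h
  exact h

theorem pt_energy (ht : t ∈ Icc (0 : ℝ) T) (x : ℝ) : pt S.energy t x = px S.energyFlux t x := by
  have hu := JointlySmooth.hasDerivAt_px S.smooth_u t x
  have h1 : px S.energyFlux t x
      = (px S.u t x * S.visc t x + S.u t x * px S.visc t x)
        + (px S.conduct t x * px S.θ t x + S.conduct t x * px (px S.θ) t x)
        - (px S.pressure t x * S.u t x + S.pressure t x * px S.u t x) - px S.q t x :=
    ((((hu.mul (S.smooth_visc.hasDerivAt_px t x)).add ((S.smooth_conduct.hasDerivAt_px t x).mul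
      ((JointlySmooth.px_smooth S.smooth_θ).hasDerivAt_px t x))).sub
      ((S.smooth_pressure.hasDerivAt_px t x).mul hu)).sub
      (JointlySmooth.hasDerivAt_px S.smooth_q t x)).deriv
  linarith [energy_balance ht x (S := S)]

theorem mass_conserved (ht : t ∈ Icc (0 : ℝ) T) : tInt (S.v t) = 1 :=
  (tInt_const_in_time S.smooth_v S.smooth_u S.periodic_u (fun _ hs x => pt_v hs x) ht).trans
    S.mean_v

theorem momentum_conserved (ht : t ∈ Icc (0 : ℝ) T) : tInt (S.u t) = tInt (S.u 0) :=
  tInt_const_in_time S.smooth_u S.smooth_stress S.periodic_stress (fun _ hs x => pt_u hs x) ht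

theorem energy_conserved (ht : t ∈ Icc (0 : ℝ) T) : tInt (S.energy t) = tInt (S.energy 0) :=
  tInt_const_in_time S.smooth_energy S.smooth_energyFlux S.periodic_energyFlux
    (fun _ hs x => pt_energy hs x) ht

theorem continuous_θ (S : Sol μ R a b κ₁ κ₂ β γ T) (t : ℝ) : Continuous (S.θ t) :=
  (JointlySmooth.slice S.smooth_θ t).continuous

theorem continuous_u (S : Sol μ R a b κ₁ κ₂ β γ T) (t : ℝ) : Continuous (S.u t) :=
  (JointlySmooth.slice S.smooth_u t).continuous

theorem continuous_v (S : Sol μ R a b κ₁ κ₂ β γ T) (t : ℝ) : Continuous (S.v t) :=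
  (JointlySmooth.slice S.smooth_v t).continuous

theorem tInt_energy (S : Sol μ R a b κ₁ κ₂ β γ T) (t : ℝ) :
    tInt (S.energy t) = R / (γ - 1) * tInt (S.θ t) + L2sq (S.u t) / 2 := by
  have hc : Continuous fun x => S.u t x ^ 2 := (S.continuous_u t).pow 2
  unfold L2sq
  rw [← tInt_const_mul, div_eq_inv_mul (tInt _), ← tInt_const_mul,
    ← tInt_add (continuous_const_mul _ (S.continuous_θ t)) (continuous_const_mul _ hc)]
  congr 1
  funext x
  unfold energy
  ring

/-- Bound of the initial energy by the size of the data. -/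
theorem energy_initial_le {M ε : ℝ} (hR : 0 < R) (hγ : 1 < γ) (hM : 0 ≤ M)
    (hS : S.Bounded M ε) : tInt (S.energy 0) ≤ R / (γ - 1) * (1 + M ^ 2) + M ^ 2 := by
  obtain ⟨hu, hθ⟩ := L2sq_le_of_dataBounded hM hS
  have hcv : 0 < R / (γ - 1) := div_pos hR (sub_pos.2 hγ)
  have h1 : tInt (S.θ 0) ≤ 1 + L2sq (S.θ 0) := by
    have hc := S.continuous_θ 0
    have hc2 : Continuous fun x => S.θ 0 x ^ 2 := hc.pow 2
    unfold L2sq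
    nth_rw 1 [← tInt_const 1]
    rw [← tInt_add continuous_const hc2]
    refine tInt_mono hc (continuous_const.add hc2) fun x _ => ?_
    nlinarith [sq_nonneg (S.θ 0 x - 1)]
  rw [tInt_energy]
  have h2 := mul_le_mul_of_nonneg_left (h1.trans (add_le_add_right hθ 1)) hcv.le
  nlinarith [sq_nonneg M]

theorem energy_bounds {A : ℝ} (hR : 0 < R) (hγ : 1 < γ) (hA : tInt (S.energy 0) ≤ A)
    (ht : t ∈ Icc (0 : ℝ) T) : R / (γ - 1) * tInt (S.θ t) ≤ A ∧ L2sq (S.u t) ≤ 2 * A := by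
  have hcv : 0 < R / (γ - 1) := div_pos hR (sub_pos.2 hγ)
  have h1 : 0 ≤ tInt (S.θ t) := tInt_nonneg fun x => (S.θ_pos t x).le
  have h2 : 0 ≤ L2sq (S.u t) := tInt_nonneg fun x => sq_nonneg _
  rw [← energy_conserved ht, tInt_energy] at hA
  have := mul_nonneg hcv.le h1
  constructor <;> linarith

/-- The differential inequality satisfied at a spatial minimum of the temperature. -/
theorem pt_θ_lower_at_min (hμ : 0 < μ) (ha : 0 < a) (hb : 0 < b)
    (hκ₁ : 0 < κ₁) (hκ₂ : 0 < κ₂) (ht : t ∈ Icc (0 : ℝ) T) {x : ℝ}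
    (hx : ∀ y, S.θ t x ≤ S.θ t y) :
    -(R ^ 2 / (4 * μ * S.v t x)) * S.θ t x ^ 2 ≤ R / (γ - 1) * pt S.θ t x := by
  have hq : px S.q t x ≤ 0 :=
    deriv_flux_nonpos_of_min ha hb (JointlySmooth.slice S.smooth_v t)
      (JointlySmooth.slice S.smooth_θ t) (JointlySmooth.slice S.smooth_q t) (S.periodic_v t)
      (S.periodic_θ t) (S.periodic_q t) (S.v_pos t) (S.θ_pos t) (S.eq_rad t ht) hx
  have hmin : IsLocalMin (S.θ t) x := Filter.Eventually.of_forall hx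
  have h1 : px S.θ t x = 0 := hmin.deriv_eq_zero
  have h2 : 0 ≤ px (px S.θ) t x :=
    deriv_deriv_nonneg_of_isLocalMin hmin (S.continuous_θ t).continuousAt
  have hk : 0 ≤ S.conduct t x := by
    have := S.v_pos t x
    have := Real.rpow_pos_of_pos (S.θ_pos t x) β
    unfold conduct kappa
    positivity
  have hE : pt S.energy t x = R / (γ - 1) * pt S.θ t x + S.u t x * pt S.u t x := by
    have := (((JointlySmooth.hasDerivAt_pt S.smooth_θ t x).const_mul (R / (γ - 1))).add
      (((JointlySmooth.hasDerivAt_pt S.smooth_u t x).pow 2).div_const 2)).deriv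
    rw [show pt S.energy t x = _ from this]
    push_cast
    ring
  have hm : pt S.u t x + px S.pressure t x = px S.visc t x := S.eq_mom t ht x
  have hb := energy_balance ht x (S := S)
  rw [hE, h1, ← hm] at hb
  have hv := S.v_pos t x
  have hsq : -(R ^ 2 / (4 * μ * S.v t x)) * S.θ t x ^ 2
      ≤ px S.u t x * S.visc t x - S.pressure t x * px S.u t x := by
    have : px S.u t x * S.visc t x - S.pressure t x * px S.u t x
        - -(R ^ 2 / (4 * μ * S.v t x)) * S.θ t x ^ 2
        = (2 * μ * px S.u t x - R * S.θ t x) ^ 2 / (4 * μ * S.v t x) := by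
      unfold visc pressure
      field_simp
      ring
    have h0 : 0 ≤ (2 * μ * px S.u t x - R * S.θ t x) ^ 2 / (4 * μ * S.v t x) := by positivity
    linarith
  have := mul_nonneg hk h2
  linarith

end Sol

end RadHydro

namespace RadHydro

namespace Sol

variable {μ R a b κ₁ κ₂ β γ T : ℝ} (S : Sol μ R a b κ₁ κ₂ β γ T)

/-- The spatial primitive of the velocity fluctuation. -/
def velPrim (t x : ℝ) : ℝ := ∫ y in (-(1/2) : ℝ)..x, (S.u t y - tInt (S.u 0))

/-- The time derivative of `velPrim`. -/
def accPrim (t x : ℝ) : ℝ := ∫ y in (-(1/2) : ℝ)..x, pt S.u t y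

theorem continuous_velPrim : Continuous fun p : ℝ × ℝ => S.velPrim p.1 p.2 := by
  have h : Continuous (Function.uncurry fun (p : ℝ × ℝ) (y : ℝ) => S.u p.1 y - tInt (S.u 0)) :=
    (S.smooth_u.continuous.comp ((continuous_fst.comp continuous_fst).prodMk
      continuous_snd)).sub continuous_const
  exact intervalIntegral.continuous_parametric_intervalIntegral_of_continuous h continuous_snd

theorem continuous_accPrim : Continuous fun p : ℝ × ℝ => S.accPrim p.1 p.2 := by
  have h : Continuous (Function.uncurry fun (p : ℝ × ℝ) (y : ℝ) => pt S.u p.1 y) :=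
    (JointlySmooth.pt_smooth S.smooth_u).continuous.comp
      ((continuous_fst.comp continuous_fst).prodMk continuous_snd)
  exact intervalIntegral.continuous_parametric_intervalIntegral_of_continuous h continuous_snd

theorem hasDerivAt_velPrim_time (t x : ℝ) :
    HasDerivAt (fun s => S.velPrim s x) (S.accPrim t x) t :=
  hasDerivAt_intervalIntegral_param (F := fun s y => S.u s y - tInt (S.u 0))
    (S.smooth_u.continuous.sub continuous_const) (JointlySmooth.pt_smooth S.smooth_u).continuous
    (fun s y => (JointlySmooth.hasDerivAt_pt S.smooth_u s y).sub_const _) _ _ t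

theorem hasDerivAt_velPrim_space (t x : ℝ) :
    HasDerivAt (S.velPrim t) (S.u t x - tInt (S.u 0)) x :=
  have hc : Continuous fun y => S.u t y - tInt (S.u 0) :=
    (S.continuous_u t).sub continuous_const
  hc.integral_hasStrictDerivAt _ x |>.hasDerivAt

theorem velPrim_left (t : ℝ) : S.velPrim t (-(1/2)) = 0 := intervalIntegral.integral_same

variable {S} {t : ℝ}

theorem velPrim_right (ht : t ∈ Icc (0 : ℝ) T) : S.velPrim t (1/2) = 0 := by
  have h : S.velPrim t (1/2) = tInt (S.u t) - tInt fun _ => tInt (S.u 0) :=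
    tInt_sub (S.continuous_u t) continuous_const
  rw [h, tInt_const, momentum_conserved ht, sub_self]

theorem accPrim_eq (ht : t ∈ Icc (0 : ℝ) T) (x : ℝ) :
    S.accPrim t x = S.stress t x - S.stress t (-(1/2)) := by
  unfold accPrim
  rw [funext (pt_u ht)]
  exact intervalIntegral.integral_eq_sub_of_hasDerivAt
    (fun y _ => S.smooth_stress.hasDerivAt_px t y)
    ((S.smooth_stress.px_smooth.slice t).continuous.intervalIntegrable _ _)

theorem tInt_fluctuation_sq (ht : t ∈ Icc (0 : ℝ) T) :
    tInt (fun x => S.u t x * (S.u t x - tInt (S.u 0))) ≤ L2sq (S.u t) := by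
  have hc := S.continuous_u t
  have hc2 : Continuous fun x => S.u t x ^ 2 := hc.pow 2
  have h : (fun x => S.u t x * (S.u t x - tInt (S.u 0)))
      = fun x => S.u t x ^ 2 - tInt (S.u 0) * S.u t x := by funext x; ring
  rw [h, tInt_sub hc2 (continuous_const_mul _ hc), tInt_const_mul, momentum_conserved ht]
  unfold L2sq
  nlinarith [sq_nonneg (tInt (S.u 0))]

theorem abs_velPrim_le {A : ℝ} (hA : L2sq (S.u t) ≤ 2 * A) (ht : t ∈ Icc (0 : ℝ) T)
    {x : ℝ} (hx : x ∈ Icc (-(1/2) : ℝ) (1/2)) : |S.velPrim t x| ≤ 1 + 2 * A := by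
  have hc := S.continuous_u t
  set c := tInt (S.u 0) with hcdef
  have hd : Continuous fun y => S.u t y - c := hc.sub continuous_const
  have h1 : |S.velPrim t x| ≤ ∫ y in (-(1/2) : ℝ)..x, |S.u t y - c| :=
    intervalIntegral.abs_integral_le_integral_abs hx.1
  have h2 : (∫ y in (-(1/2) : ℝ)..x, |S.u t y - c|) ≤ tInt fun y => |S.u t y - c| :=
    intervalIntegral.integral_mono_interval le_rfl hx.1 hx.2
      (Filter.Eventually.of_forall fun y => abs_nonneg _) (hd.abs.intervalIntegrable _ _)
  have h3 : tInt (fun y => |S.u t y - c|) ≤ 1 + L2sq (S.u t) := by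
    have hm : Continuous fun y => S.u t y * (S.u t y - c) := hc.mul hd
    have hs : Continuous fun y => S.u t y * (S.u t y - c) - c * (S.u t y - c) :=
      hm.sub (continuous_const_mul c hd)
    have h4 : tInt (fun y => |S.u t y - c|)
        ≤ tInt fun y => 1 + (S.u t y * (S.u t y - c) - c * (S.u t y - c)) := by
      refine tInt_mono hd.abs (continuous_const.add hs) fun y _ => ?_
      nlinarith [sq_nonneg (|S.u t y - c| - 1), sq_abs (S.u t y - c), abs_nonneg (S.u t y - c)]
    rw [tInt_add continuous_const hs, tInt_const, tInt_sub hm (continuous_const_mul c hd),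
      tInt_const_mul, tInt_sub hc continuous_const, tInt_const, momentum_conserved ht] at h4
    have := tInt_fluctuation_sq ht (S := S)
    rw [← hcdef] at h4 this
    linarith
  linarith

theorem abs_tInt_v_mul_velPrim_le {A : ℝ} (hA : L2sq (S.u t) ≤ 2 * A)
    (ht : t ∈ Icc (0 : ℝ) T) : |tInt fun x => S.v t x * S.velPrim t x| ≤ 1 + 2 * A := by
  have hv := S.continuous_v t
  have hU : Continuous (S.velPrim t) := S.continuous_velPrim.comp (Continuous.prodMk_right t)
  have h1 : |tInt fun x => S.v t x * S.velPrim t x| ≤ tInt fun x => |S.v t x * S.velPrim t x| :=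
    intervalIntegral.abs_integral_le_integral_abs (by norm_num)
  refine h1.trans ?_
  have h2 : 1 + 2 * A = tInt fun x => (1 + 2 * A) * S.v t x := by
    rw [tInt_const_mul, mass_conserved ht, mul_one]
  rw [h2]
  refine tInt_mono (hv.mul hU).abs (continuous_const.mul hv) fun x hx => ?_
  rw [abs_mul, abs_of_pos (S.v_pos t x), mul_comm]
  exact mul_le_mul_of_nonneg_right (abs_velPrim_le hA ht hx) (S.v_pos t x).le

theorem hasDerivAt_tInt_v_mul_velPrim (S : Sol μ R a b κ₁ κ₂ β γ T) (t : ℝ) :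
    HasDerivAt (fun s => tInt fun x => S.v s x * S.velPrim s x)
      (tInt fun x => pt S.v t x * S.velPrim t x + S.v t x * S.accPrim t x) t :=
  hasDerivAt_intervalIntegral_param (F := fun s x => S.v s x * S.velPrim s x)
    (S.smooth_v.continuous.mul S.continuous_velPrim)
    (((JointlySmooth.pt_smooth S.smooth_v).continuous.mul S.continuous_velPrim).add
      (S.smooth_v.continuous.mul S.continuous_accPrim))
    (fun s x => (JointlySmooth.hasDerivAt_pt S.smooth_v s x).mul
      (S.hasDerivAt_velPrim_time s x)) _ _ t

/-- Evolution of the volume-weighted mean of `velPrim`. -/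
theorem tInt_deriv_v_mul_velPrim (ht : t ∈ Icc (0 : ℝ) T) :
    tInt (fun x => pt S.v t x * S.velPrim t x + S.v t x * S.accPrim t x)
      = -tInt (fun x => S.u t x * (S.u t x - tInt (S.u 0))) - R * tInt (S.θ t)
        - S.stress t (-(1/2)) := by
  have hv := S.continuous_v t
  have hu := S.continuous_u t
  have hd : Continuous fun y => S.u t y - tInt (S.u 0) := hu.sub continuous_const
  have hU : Continuous (S.velPrim t) := S.continuous_velPrim.comp (Continuous.prodMk_right t)
  have hux : Continuous (px S.u t) := ((JointlySmooth.px_smooth S.smooth_u).slice t).continuous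
  have hθ := S.continuous_θ t
  have hsplit : (fun x => pt S.v t x * S.velPrim t x + S.v t x * S.accPrim t x)
      = fun x => px S.u t x * S.velPrim t x
        + (μ * px S.u t x - R * S.θ t x - S.stress t (-(1/2)) * S.v t x) := by
    funext x
    rw [pt_v ht, accPrim_eq ht]
    have := S.v_ne t x
    simp only [stress, visc, pressure]
    field_simp
  have hparts : tInt (fun x => px S.u t x * S.velPrim t x)
      = -tInt (fun x => S.u t x * (S.u t x - tInt (S.u 0))) := by
    have := intervalIntegral.integral_mul_deriv_eq_deriv_mul (a := (-(1/2) : ℝ)) (b := 1/2)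
      (fun x _ => JointlySmooth.hasDerivAt_px S.smooth_u t x)
      (fun x _ => S.hasDerivAt_velPrim_space t x) (hux.intervalIntegrable _ _)
      (hd.intervalIntegrable _ _)
    rw [velPrim_right ht, velPrim_left] at this
    unfold tInt at this ⊢
    linarith
  have hux0 : tInt (px S.u t) = 0 :=
    tInt_deriv_of_periodic ((JointlySmooth.slice S.smooth_u t).of_le (by exact_mod_cast le_top))
      (S.periodic_u t)
  have c₁ : Continuous fun x => px S.u t x * S.velPrim t x := hux.mul hU
  have c₂ := continuous_const_mul μ hux
  have c₃ := continuous_const_mul R hθ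
  have c₄ := continuous_const_mul (S.stress t (-(1/2))) hv
  have c₅ : Continuous fun x => μ * px S.u t x - R * S.θ t x := c₂.sub c₃
  have c₆ : Continuous fun x =>
      μ * px S.u t x - R * S.θ t x - S.stress t (-(1/2)) * S.v t x := c₅.sub c₄
  rw [hsplit, tInt_add c₁ c₆, hparts, tInt_sub c₅ c₄, tInt_sub c₂ c₃,
    tInt_const_mul, tInt_const_mul, tInt_const_mul, hux0, mass_conserved ht]
  ring

/-- Lower bound for the specific volume. -/
theorem v_lower_bound {A ε : ℝ} (hμ : 0 < μ) (hR : 0 < R) (hγ : 1 < γ) (hε : 0 < ε)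
    (hA : tInt (S.energy 0) ≤ A) (hv0 : ∀ x, ε ≤ S.v 0 x) (ht : t ∈ Icc (0 : ℝ) T)
    {x : ℝ} (hx : x ∈ Icc (-(1/2) : ℝ) (1/2)) :
    Real.exp ((μ * Real.log ε - 4 * (1 + 2 * A) - (2 * A + (γ - 1) * A) * T) / μ) ≤ S.v t x := by
  have hγ' : 0 < γ - 1 := sub_pos.2 hγ
  set K := 2 * A + (γ - 1) * A with hK
  set H : ℝ → ℝ := fun s => μ * Real.log (S.v s x) - S.velPrim s x
    + (tInt fun y => S.v s y * S.velPrim s y) + K * s with hH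
  have hderiv : ∀ s, HasDerivAt H (μ * (pt S.v s x / S.v s x) - S.accPrim s x
      + (tInt fun y => pt S.v s y * S.velPrim s y + S.v s y * S.accPrim s y) + K * 1) s := fun s =>
    ((((JointlySmooth.hasDerivAt_pt S.smooth_v s x).log (S.v_ne s x)).const_mul μ).sub
      (S.hasDerivAt_velPrim_time s x)).add (S.hasDerivAt_tInt_v_mul_velPrim s)
      |>.add ((hasDerivAt_id s).const_mul K)
  have hmono : MonotoneOn H (Icc 0 T) := by
    refine monotoneOn_of_deriv_nonneg (convex_Icc 0 T)
      (fun s _ => (hderiv s).continuousAt.continuousWithinAt)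
      (fun s _ => (hderiv s).differentiableAt.differentiableWithinAt) fun s hs => ?_
    have hs' : s ∈ Icc (0 : ℝ) T := interior_subset hs
    obtain ⟨hθ, hu⟩ := energy_bounds hR hγ hA hs'
    have hf := (tInt_fluctuation_sq hs').trans hu
    have hθ' : R * tInt (S.θ s) ≤ (γ - 1) * A := by
      have := mul_le_mul_of_nonneg_left hθ hγ'.le
      calc R * tInt (S.θ s) = (γ - 1) * (R / (γ - 1) * tInt (S.θ s)) := by field_simp
        _ ≤ _ := this
    have hp : 0 ≤ S.pressure s x :=
      div_nonneg (mul_nonneg hR.le (S.θ_pos s x).le) (S.v_pos s x).le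
    have hvisc : μ * (px S.u s x / S.v s x) = S.visc s x := by unfold visc; ring
    rw [(hderiv s).deriv, tInt_deriv_v_mul_velPrim hs', accPrim_eq hs', pt_v hs', hvisc]
    unfold stress at *
    linarith
  have h0 : (0 : ℝ) ∈ Icc (0 : ℝ) T := ⟨le_rfl, ht.1.trans ht.2⟩
  have hle := hmono h0 ht ht.1
  obtain ⟨hθt, hut⟩ := energy_bounds hR hγ hA ht
  have hu0 := (energy_bounds hR hγ hA h0).2
  have b1 := abs_le.1 (abs_velPrim_le hut ht hx)
  have b2 := abs_le.1 (abs_velPrim_le hu0 h0 hx)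
  have b3 := abs_le.1 (abs_tInt_v_mul_velPrim_le hut ht)
  have b4 := abs_le.1 (abs_tInt_v_mul_velPrim_le hu0 h0)
  have hlog := mul_le_mul_of_nonneg_left (Real.log_le_log hε (hv0 x)) hμ.le
  have hA0 : 0 ≤ A := by
    have : 0 ≤ L2sq (S.u t) := tInt_nonneg fun x => sq_nonneg _
    linarith
  have hK0 : 0 ≤ K := by positivity
  have hKt := mul_le_mul_of_nonneg_left ht.2 hK0
  simp only [hH] at hle
  rw [← Real.le_log_iff_exp_le (S.v_pos t x), div_le_iff₀ hμ]
  linarith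

end Sol

end RadHydro

theorem stmt_19 (μ R a b κ₁ κ₂ β γ : ℝ)
    (hμ : 0 < μ) (hR : 0 < R) (ha : 0 < a) (hb : 0 < b)
    (hκ₁ : 0 < κ₁) (hκ₂ : 0 < κ₂) (hβ : 157 / 17 < β) (hγ : 1 < γ)
    (T M ε : ℝ) (hT : 0 < T) (hM : 1 ≤ M) (hε0 : 0 < ε) (hε1 : ε ≤ 1) :
    ∃ C : ℝ, 0 < C ∧
      ∀ S : Sol μ R a b κ₁ κ₂ β γ T, S.Bounded M ε →
        ∀ t ∈ Icc (0 : ℝ) T,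
          ∀ x : ℝ, C ≤ S.θ t x := by
  have hcv : 0 < R / (γ - 1) := div_pos hR (sub_pos.2 hγ)
  set A := R / (γ - 1) * (1 + M ^ 2) + M ^ 2
  set m := Real.exp ((μ * Real.log ε - 4 * (1 + 2 * A) - (2 * A + (γ - 1) * A) * T) / μ)
  have hm : 0 < m := Real.exp_pos _
  set L := R ^ 2 / (4 * μ * m) / (R / (γ - 1)) with hL
  have hL0 : 0 < L := by positivity
  refine ⟨(1 / ε + (L + 1) * T)⁻¹, by positivity, fun S hS t ht x => ?_⟩
  have hA := Sol.energy_initial_le hR hγ (zero_le_one.trans hM) hS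
  have hWc : ContinuousOn (fun p : ℝ × ℝ => (S.θ p.1 p.2)⁻¹ - (L + 1) * p.1)
      (Icc 0 T ×ˢ Icc (-(1/2)) (1/2)) :=
    ((S.smooth_θ.continuous.inv₀ fun p => (S.θ_pos p.1 p.2).ne').sub
      (continuous_const.mul continuous_fst)).continuousOn
  have fold : ∀ s y, ∃ z ∈ Icc (-(1/2) : ℝ) (1/2), S.θ s y = S.θ s z := fun s y => by
    obtain ⟨z, hz, hyz⟩ := (S.periodic_θ s).exists_mem_Ico one_pos y (-(1/2))
    exact ⟨z, ⟨hz.1, by linarith [hz.2]⟩, hyz⟩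
  obtain ⟨⟨t₁, x₁⟩, ⟨ht₁, hx₁⟩, hmax⟩ := (isCompact_Icc.prod isCompact_Icc).exists_isMaxOn
    ⟨((0 : ℝ), (0 : ℝ)), ⟨le_rfl, hT.le⟩, by norm_num, by norm_num⟩ hWc
  have hmax' : ∀ s ∈ Icc (0 : ℝ) T, ∀ y,
      (S.θ s y)⁻¹ - (L + 1) * s ≤ (S.θ t₁ x₁)⁻¹ - (L + 1) * t₁ := fun s hs y => by
    obtain ⟨z, hz, hyz⟩ := fold s y
    rw [hyz]
    exact hmax (show (s, z) ∈ Icc (0 : ℝ) T ×ˢ Icc (-(1/2) : ℝ) (1/2) from ⟨hs, hz⟩)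
  have ht₁0 : t₁ = 0 := by
    by_contra hne
    have hpos : 0 < t₁ := lt_of_le_of_ne ht₁.1 (Ne.symm hne)
    have hθ := S.θ_pos t₁ x₁
    have hmin : ∀ y, S.θ t₁ x₁ ≤ S.θ t₁ y := fun y =>
      (inv_le_inv₀ (S.θ_pos t₁ y) hθ).1 (by linarith [hmax' t₁ ht₁ y])
    have hv := Sol.v_lower_bound hμ hR hγ hε0 hA hS.2.1 ht₁ hx₁
    have hlow := Sol.pt_θ_lower_at_min hμ ha hb hκ₁ hκ₂ ht₁ hmin
    have hd := ((JointlySmooth.hasDerivAt_pt S.smooth_θ t₁ x₁).inv hθ.ne').sub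
      ((hasDerivAt_id t₁).const_mul (L + 1))
    have hnn := deriv_nonneg_of_le_left hpos hd fun s hs => hmax' s ⟨hs.1, hs.2.trans ht₁.2⟩ x₁
    have hθ2 : 0 < S.θ t₁ x₁ ^ 2 := by positivity
    have h1 : L + 1 ≤ -pt S.θ t₁ x₁ / S.θ t₁ x₁ ^ 2 := by linarith
    rw [le_div_iff₀ hθ2] at h1
    have h2 : R ^ 2 / (4 * μ * S.v t₁ x₁) ≤ R / (γ - 1) * L := by
      rw [hL, mul_div_cancel₀ _ hcv.ne']
      gcongr
    have h3 := mul_le_mul_of_nonneg_right h2 hθ2.le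
    have h4 := mul_le_mul_of_nonneg_left h1 hcv.le
    have h5 := mul_pos hcv hθ2
    linarith
  have h := hmax' t ht x
  rw [ht₁0, mul_zero, sub_zero] at h
  have h0 : (S.θ 0 x₁)⁻¹ ≤ 1 / ε := by
    rw [one_div]
    exact inv_anti₀ hε0 (hS.2.2 x₁)
  have hLt : (L + 1) * t ≤ (L + 1) * T := mul_le_mul_of_nonneg_left ht.2 (by positivity)
  exact inv_le_of_inv_le₀ (S.θ_pos t x) (by linarith)
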